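/- Suppose F(X_1,…,X_m,Z,T) = f(Z,T) + X_1⋯X_m·g(X_1,…,X_m,Z,T) for some g ∈ k[X_1,…,X_m,Z,T]. Then the following statements are equivalent: (i) A is a unique factorization domain; (ii) for each j with 1 ≤ j ≤ m, the image x_j is either a prime element of A or a unit of A; (iii) f(Z,T) is either an irreducible element of k[Z,T] or a nonzero element of k. -/

import Mathlib

/-!
Common definitions: exponential maps, the Derksen and Makar-Limanov invariants,
𝔸ⁿ-fibrations, and the ring
`A = k[X_1,…,X_m,Y,Z,T]/(X_1^{r_1}⋯X_m^{r_m}·Y − F(X_1,…,X_m,Z,T))`.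
-/

noncomputable section
open MvPolynomial

/-- An exponential map on a `k`-algebra `D`: a `k`-algebra homomorphism `φ : D → D[U]`
such that evaluating `U` at `0` gives the identity of `D`, and such that
`φ_V ∘ φ_U = φ_{U+V}` in `D[U,V]` (where `φ_V : D[U] → D[U,V]` extends `φ` with
`φ_V(U) = U`).  Here `D[U,V]` is modelled as `Polynomial (Polynomial D)`, with inner
variable `U` and outer variable `V`. -/
structure ExpMap (k D : Type) [CommRing k] [CommRing D] [Algebra k D] where
  toAlgHom : D →ₐ[k] Polynomial D
  eval_zero : ∀ d, Polynomial.eval 0 (toAlgHom d) = d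
  comp_add : ∀ d,
    Polynomial.eval₂ ((Polynomial.mapRingHom (Polynomial.C (R := D))).comp toAlgHom.toRingHom)
      (Polynomial.C Polynomial.X) (toAlgHom d)
    = Polynomial.eval₂ ((Polynomial.C (R := Polynomial D)).comp (Polynomial.C (R := D)))
      (Polynomial.C Polynomial.X + Polynomial.X) (toAlgHom d)

namespace ExpMap
variable {k D : Type} [CommRing k] [CommRing D] [Algebra k D]

/-- The ring of invariants `D^φ = {d ∈ D | φ(d) = d}` of an exponential map. -/
def invariants (φ : ExpMap k D) : Subalgebra k D where
  carrier := {d | φ.toAlgHom d = Polynomial.C d}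
  mul_mem' := fun ha hb => by
    simp only [Set.mem_setOf_eq] at *
    rw [map_mul, ha, hb, ← map_mul]
  add_mem' := fun ha hb => by
    simp only [Set.mem_setOf_eq] at *
    rw [map_add, ha, hb, ← map_add]
  algebraMap_mem' := fun c => by
    simp only [Set.mem_setOf_eq, AlgHom.commutes, Polynomial.algebraMap_apply]

end ExpMap

/-- The Derksen invariant `DK(D)`: the `k`-subalgebra of `D` generated by the rings of
invariants of all non-trivial exponential maps on `D`. -/
def Derksen (k D : Type) [CommRing k] [CommRing D] [Algebra k D] : Subalgebra k D :=
  Algebra.adjoin k (⋃ φ ∈ {ψ : ExpMap k D | ψ.invariants ≠ ⊤}, (φ.invariants : Set D))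

/-- The Makar-Limanov invariant `ML(D)`: the intersection of the rings of invariants of
all exponential maps on `D`. -/
def MakarLimanov (k D : Type) [CommRing k] [CommRing D] [Algebra k D] : Subalgebra k D :=
  ⨅ φ : ExpMap k D, φ.invariants

/-- `D` is an `𝔸ⁿ`-fibration over `R`: a finitely generated flat `R`-algebra all of whose
fibres `D ⊗_R κ(p)` over primes `p` of `R` are polynomial rings `κ(p)^{[n]}`. -/
def IsAnFibration (R D : Type) [CommRing R] [CommRing D] [Algebra R D] (n : ℕ) : Prop :=
  Algebra.FiniteType R D ∧ Module.Flat R D ∧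
  ∀ p : PrimeSpectrum R,
    Nonempty ((TensorProduct R (IsLocalRing.ResidueField (Localization.AtPrime p.asIdeal)) D)
      ≃ₐ[IsLocalRing.ResidueField (Localization.AtPrime p.asIdeal)]
      MvPolynomial (Fin n) (IsLocalRing.ResidueField (Localization.AtPrime p.asIdeal)))

/-- The polynomial ring `k[X_1,…,X_m,Y,Z,T]`:
variables `Sum.inl i` are the `X i`; `Sum.inr 0 = Y`, `Sum.inr 1 = Z`, `Sum.inr 2 = T`. -/
abbrev BigP (k : Type) [CommRing k] (m : ℕ) := MvPolynomial (Fin m ⊕ Fin 3) k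

/-- The inclusion `k[X_1,…,X_m,Z,T] → k[X_1,…,X_m,Y,Z,T]` (in the source,
`Sum.inr 0 = Z` and `Sum.inr 1 = T`). -/
def incl (k : Type) [CommRing k] (m : ℕ) : MvPolynomial (Fin m ⊕ Fin 2) k →ₐ[k] BigP k m :=
  rename (Sum.map id Fin.succ)

/-- The polynomial `G = X_1^{r_1}⋯X_m^{r_m}·Y − F(X_1,…,X_m,Z,T)`. -/
def relG (k : Type) [CommRing k] (m : ℕ) (r : Fin m → ℕ) (F : MvPolynomial (Fin m ⊕ Fin 2) k) :
    BigP k m :=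
  (∏ i, X (Sum.inl i) ^ r i) * X (Sum.inr 0) - incl k m F

/-- The ring `A = k[X_1,…,X_m,Y,Z,T]/(X_1^{r_1}⋯X_m^{r_m}·Y − F(X_1,…,X_m,Z,T))`. -/
abbrev RingA (k : Type) [CommRing k] (m : ℕ) (r : Fin m → ℕ)
    (F : MvPolynomial (Fin m ⊕ Fin 2) k) :=
  BigP k m ⧸ Ideal.span {relG k m r F}

variable (k : Type) [CommRing k] (m : ℕ) (r : Fin m → ℕ) (F : MvPolynomial (Fin m ⊕ Fin 2) k)

/-- `x i`, the image of `X i` in `A`. -/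
def xA (i : Fin m) : RingA k m r F := Ideal.Quotient.mk _ (X (Sum.inl i))
/-- `y`, the image of `Y` in `A`. -/
def yA : RingA k m r F := Ideal.Quotient.mk _ (X (Sum.inr 0))
/-- `z`, the image of `Z` in `A`. -/
def zA : RingA k m r F := Ideal.Quotient.mk _ (X (Sum.inr 1))
/-- `t`, the image of `T` in `A`. -/
def tA : RingA k m r F := Ideal.Quotient.mk _ (X (Sum.inr 2))

/-- `f(Z,T) := F(0,…,0,Z,T) ∈ k[Z,T]`. -/
def fOf : MvPolynomial (Fin 2) k :=
  aeval (Sum.elim (fun _ => (0 : MvPolynomial (Fin 2) k)) X) F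

/-- The subalgebra `E = k[x_1,…,x_m]` of `A`. -/
def EA : Subalgebra k (RingA k m r F) := Algebra.adjoin k (Set.range (xA k m r F))

/-- The subalgebra `B = k[x_1,…,x_m,z,t]` of `A`. -/
def BA : Subalgebra k (RingA k m r F) :=
  Algebra.adjoin k (Set.range (xA k m r F) ∪ {zA k m r F, tA k m r F})

/-- An element not divisible by any of the primes in a set `s` can be cancelled from products with
elements generated by `s`, if every element of `s` is prime or a unit. -/
theorem dvd_of_dvd_mul_of_mem_closure {A : Type*} [CommRing A] [IsDomain A] {s : Set A}
    (hs : ∀ x ∈ s, Prime x ∨ IsUnit x) {q : A} (hq : ∀ x ∈ s, Prime x → ¬ x ∣ q)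
    {d : A} (hd : d ∈ Submonoid.closure s) {a : A} (h : q ∣ d * a) : q ∣ a := by
  induction hd using Submonoid.closure_induction generalizing a with
  | mem x hx =>
    rcases hs x hx with hp | hu
    · obtain ⟨c, hc⟩ := h
      obtain ⟨c', rfl⟩ := (hp.dvd_or_dvd ⟨a, hc.symm⟩).resolve_left (hq x hx hp)
      exact ⟨c', mul_left_cancel₀ hp.ne_zero (by rw [hc]; ring)⟩
    · exact (hu.dvd_mul_left).1 h
  | one => simpa using h
  | mul x y _ _ hx hy => exact hy (hx (by rwa [← mul_assoc]))

/-- Nagata's criterion for factoriality, for a domain `A` and a factorial subring that become equal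
after inverting elements which are prime or invertible in `A`. -/
theorem UniqueFactorizationMonoid.of_prime_or_isUnit_of_injective {R A : Type*} [CommRing R]
    [IsDomain R] [UniqueFactorizationMonoid R] [CommRing A] [IsDomain A] [IsNoetherianRing A]
    (φ : R →+* A) (hφ : Function.Injective φ) (s : Set R)
    (hs : ∀ x ∈ s, Prime (φ x) ∨ IsUnit (φ x))
    (hA : ∀ a, ∃ d ∈ Submonoid.closure s, ∃ b, φ d * a = φ b) :
    UniqueFactorizationMonoid A := by
  have hs' : ∀ x ∈ φ '' s, Prime x ∨ IsUnit x := by simpa using hs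
  have hcl : ∀ d ∈ Submonoid.closure s, φ d ∈ Submonoid.closure (φ '' s) := fun d hd => by
    have := Submonoid.mem_map_of_mem φ hd
    rwa [MonoidHom.map_mclosure] at this
  refine UniqueFactorizationMonoid.iff_exists_prime_mem_of_isPrime.2 fun P hP hPp => ?_
  by_cases h : ∃ x ∈ s, φ x ∈ P
  · obtain ⟨x, hx, hxP⟩ := h
    exact ⟨φ x, hxP, (hs x hx).resolve_right fun hu => hPp.ne_top (P.eq_top_of_isUnit_mem hxP hu)⟩
  push Not at h
  have hdP : ∀ d ∈ Submonoid.closure s, φ d ∉ P := fun d hd => by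
    have : Submonoid.closure s ≤ (P.primeCompl).comap φ := Submonoid.closure_le.2 h
    exact this hd
  obtain ⟨a, haP, ha⟩ := Submodule.exists_mem_ne_zero_of_ne_bot hP
  obtain ⟨d₀, hd₀, b, hb⟩ := hA a
  have hb0 : b ≠ 0 := by
    rintro rfl
    rw [map_zero, mul_eq_zero] at hb
    exact hb.elim (fun h0 => hdP d₀ hd₀ (h0 ▸ P.zero_mem)) ha
  have hbP : b ∈ P.comap φ := by
    rw [Ideal.mem_comap, ← hb]
    exact P.mul_mem_left _ haP
  have hne : P.comap φ ≠ ⊥ := fun h0 => hb0 (by rwa [h0, Ideal.mem_bot] at hbP)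
  obtain ⟨p, hpP, hp⟩ := Ideal.IsPrime.exists_mem_prime_of_ne_bot (hPp.comap φ) hne
  have hpd : ∀ d ∈ Submonoid.closure s, ¬ p ∣ d := fun d hd h1 =>
    hdP d hd (P.mem_of_dvd (map_dvd φ h1) hpP)
  obtain ⟨q, ⟨d, hd, hpq⟩, hmin⟩ := (IsWellFounded.wf (r := DvdNotUnit (α := A))).has_min
    {q : A | ∃ d ∈ Submonoid.closure s, φ p = φ d * q} ⟨φ p, 1, one_mem _, by simp⟩
  have hq0 : q ≠ 0 := by
    rintro rfl
    exact hp.ne_zero (hφ (by simpa using hpq))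
  have hq : ∀ x ∈ φ '' s, Prime x → ¬ x ∣ q := by
    rintro _ ⟨x, hx, rfl⟩ hxp ⟨c, rfl⟩
    refine hmin c ⟨d * x, mul_mem hd (Submonoid.subset_closure hx), ?_⟩
      ⟨right_ne_zero_of_mul hq0, φ x, hxp.not_isUnit, mul_comm _ _⟩
    rw [hpq, map_mul, mul_assoc]
  have hqP : q ∈ P := (hPp.mem_or_mem (hpq ▸ hpP : φ d * q ∈ P)).resolve_left (hdP d hd)
  have key : ∀ u v w d', d' ∈ Submonoid.closure s → φ d' * u = φ v → v = p * w → q ∣ u := by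
    intro u v w d' hd' huv hv
    refine dvd_of_dvd_mul_of_mem_closure hs' hq (hcl d' hd') ⟨φ d * φ w, ?_⟩
    rw [huv, hv, map_mul, hpq]
    ring
  refine ⟨q, hqP, hq0, fun hu => hPp.ne_top (P.eq_top_of_isUnit_mem hqP hu), ?_⟩
  rintro u v ⟨c, hc⟩
  obtain ⟨d₁, hd₁, u', hu'⟩ := hA u
  obtain ⟨d₂, hd₂, v', hv'⟩ := hA v
  obtain ⟨d₃, hd₃, c', hc'⟩ := hA c
  have hprod : d * d₃ * (u' * v') = p * (d₁ * d₂ * c') := hφ (by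
    simp only [map_mul, ← hu', ← hv', ← hc', hpq]
    linear_combination φ d * φ d₃ * φ d₁ * φ d₂ * hc)
  rcases hp.dvd_or_dvd ⟨_, hprod⟩ with h1 | h1
  · exact absurd h1 (hpd _ (mul_mem hd hd₃))
  · rcases hp.dvd_or_dvd h1 with ⟨w, hw⟩ | ⟨w, hw⟩
    · exact Or.inl (key u u' w d₁ hd₁ hu' hw)
    · exact Or.inr (key v v' w d₂ hd₂ hv' hw)

/-- A divisor of a product of powers of primes is associated to a product of powers of these
primes. -/
theorem exists_associated_prod_pow_of_dvd {R ι : Type*} [CommMonoidWithZero R]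
    [IsCancelMulZero R] [DecompositionMonoid R] {x : ι → R} (hx : ∀ i, Prime (x i))
    (s : Finset ι) (e : ι → ℕ) {d : R} (hd : d ∣ ∏ i ∈ s, x i ^ e i) :
    ∃ e' : ι → ℕ, Associated d (∏ i ∈ s, x i ^ e' i) := by
  classical
  induction s using Finset.induction_on generalizing d with
  | empty => exact ⟨0, by simpa [associated_one_iff_isUnit, isUnit_iff_dvd_one] using hd⟩
  | insert a s ha ih =>
    rw [Finset.prod_insert ha] at hd
    obtain ⟨d₁, d₂, h₁, h₂, rfl⟩ := exists_dvd_and_dvd_of_dvd_mul hd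
    obtain ⟨n, -, hn⟩ := (dvd_prime_pow (hx a) _).1 h₁
    obtain ⟨e', he'⟩ := ih h₂
    refine ⟨Function.update e' a n, ?_⟩
    rw [Finset.prod_insert ha, Function.update_self, Finset.prod_congr rfl (g := fun i => x i ^ e' i)
      fun i hi => by rw [Function.update_of_ne (ne_of_mem_of_not_mem hi ha)]]
    exact hn.mul_mul he'

/-- The image of a prime under an injective renaming of variables is prime. -/
theorem MvPolynomial.prime_rename_of_injective {R σ τ : Type*} [CommRing R] {f : σ → τ}
    (hf : Function.Injective f) {p : MvPolynomial σ R} (hp : Prime p) : Prime (rename f p) := by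
  have h : rename f p = rename Subtype.val (renameEquiv R (Equiv.ofInjective f hf) p) := by
    rw [renameEquiv_apply, rename_rename]
    rfl
  rw [h, prime_rename_iff (Set.range f)]
  exact (MulEquiv.prime_iff (renameEquiv R (Equiv.ofInjective f hf)).toMulEquiv).2 hp

/-- The natural map `k[X_1,…,X_m,Z,T] → A`. -/
def toA : MvPolynomial (Fin m ⊕ Fin 2) k →ₐ[k] RingA k m r F :=
  (Ideal.Quotient.mkₐ k _).comp (incl k m)

theorem toA_X_inl (i : Fin m) : toA k m r F (X (Sum.inl i)) = xA k m r F i := by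
  simp [toA, incl, xA]

theorem toA_injective (k : Type) [Field k] (m : ℕ) (r : Fin m → ℕ)
    (F : MvPolynomial (Fin m ⊕ Fin 2) k) : Function.Injective (toA k m r F) := by
  let L := FractionRing (MvPolynomial (Fin m ⊕ Fin 2) k)
  let ι : MvPolynomial (Fin m ⊕ Fin 2) k →ₐ[k] L := Algebra.algHom k _ L
  have hι : Function.Injective ι := IsFractionRing.injective (MvPolynomial (Fin m ⊕ Fin 2) k) L
  let ψ : BigP k m →ₐ[k] L := aeval (Sum.elim (fun i => ι (X (Sum.inl i)))
    (Fin.cons (ι F / ι (∏ i, X (Sum.inl i) ^ r i)) fun i => ι (X (Sum.inr i))))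
  have hψ : ψ.comp (incl k m) = ι := by
    ext i
    rcases i with i | i <;> simp [ψ, incl]
  have hψ' : ∀ p, ψ (incl k m p) = ι p := fun p => DFunLike.congr_fun hψ p
  have hne : ι (∏ i, X (Sum.inl i) ^ r i) ≠ 0 := by
    rw [Ne, map_eq_zero_iff ι hι, Finset.prod_eq_zero_iff]
    simp [X_ne_zero]
  have hG : ψ (relG k m r F) = 0 := by
    rw [relG, map_sub, map_mul, hψ', sub_eq_zero]
    have h0 : ψ (X (Sum.inr 0)) = ι F / ι (∏ i, X (Sum.inl i) ^ r i) := by simp [ψ]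
    have h1 : ψ (∏ i, X (Sum.inl i) ^ r i) = ι (∏ i, X (Sum.inl i) ^ r i) := by simp [ψ, map_prod]
    rw [h0, h1, mul_div_cancel₀ _ hne]
  rw [injective_iff_map_eq_zero]
  intro p hp
  obtain ⟨c, hc⟩ := Ideal.mem_span_singleton.1 (Ideal.Quotient.eq_zero_iff_mem.1 hp)
  refine hι ?_
  rw [map_zero, ← hψ', ← zero_mul (ψ c), ← hG, ← map_mul, ← hc]
  rfl

theorem mk_relG : (Ideal.Quotient.mk (Ideal.span {relG k m r F}) (relG k m r F)) = 0 :=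
  Ideal.Quotient.eq_zero_iff_mem.2 (Ideal.mem_span_singleton_self _)

theorem toA_prod_mul_yA : toA k m r F (∏ i, X (Sum.inl i) ^ r i) * yA k m r F = toA k m r F F := by
  have h : Ideal.Quotient.mk (Ideal.span {relG k m r F})
      ((∏ i, X (Sum.inl i) ^ r i) * X (Sum.inr 0) - incl k m F) = 0 := mk_relG k m r F
  have hX : incl k m (∏ i, X (Sum.inl i) ^ r i) = ∏ i, X (Sum.inl i) ^ r i := by
    simp [incl, map_prod]
  rwa [← hX, map_sub, map_mul, sub_eq_zero] at h

/-- Every element of `A` is a fraction of an element of `k[X_1,…,X_m,Z,T]` by a monomial in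
`x_1,…,x_m`. -/
theorem exists_toA_mul_eq_toA (a : RingA k m r F) :
    ∃ d ∈ Submonoid.closure
        (Set.range fun i : Fin m => (X (Sum.inl i) : MvPolynomial (Fin m ⊕ Fin 2) k)),
      ∃ b, toA k m r F d * a = toA k m r F b := by
  obtain ⟨p, rfl⟩ := Ideal.Quotient.mk_surjective a
  induction p using MvPolynomial.induction_on with
  | C c => exact ⟨1, one_mem _, C c, by
      rw [map_one, one_mul, toA, AlgHom.comp_apply, incl, rename_C]; rfl⟩
  | add p q hp hq =>
    obtain ⟨d, hd, b, hb⟩ := hp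
    obtain ⟨d', hd', b', hb'⟩ := hq
    refine ⟨d * d', mul_mem hd hd', d' * b + d * b', ?_⟩
    simp only [map_mul, map_add, ← hb, ← hb']
    ring
  | mul_X p i hp =>
    obtain ⟨d, hd, b, hb⟩ := hp
    have key : ∃ d ∈ Submonoid.closure
        (Set.range fun i : Fin m => (X (Sum.inl i) : MvPolynomial (Fin m ⊕ Fin 2) k)),
        ∃ b, toA k m r F d * Ideal.Quotient.mk _ (X i) = toA k m r F b := by
      rcases i with i | i
      · exact ⟨1, one_mem _, X (Sum.inl i), by rw [toA_X_inl, map_one, one_mul]; rfl⟩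
      · refine Fin.cases ?_ (fun i => ?_) i
        · exact ⟨∏ i, X (Sum.inl i) ^ r i,
            prod_mem fun i _ => pow_mem (Submonoid.subset_closure (Set.mem_range_self i)) (r i), F,
            toA_prod_mul_yA k m r F⟩
        · exact ⟨1, one_mem _, X (Sum.inr i), by simp [toA, incl]⟩
    obtain ⟨d', hd', b', hb'⟩ := key
    refine ⟨d * d', mul_mem hd hd', b * b', ?_⟩
    simp only [map_mul, ← hb, ← hb']
    ring

/-- The relation `X_1^{r_1}⋯X_m^{r_m}·Y − F` is congruent to `-f(Z,T)` modulo each `X_j`. -/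
theorem exists_relG_eq {f : MvPolynomial (Fin 2) k} {g : MvPolynomial (Fin m ⊕ Fin 2) k}
    (hr : ∀ i, r i ≠ 0) (hF : F = rename Sum.inr f + (∏ i, X (Sum.inl i)) * g) (j : Fin m) :
    ∃ h, relG k m r F = X (Sum.inl j) * h - rename (Sum.inr ∘ Fin.succ) f := by
  have h1 : (X (Sum.inl j) : BigP k m) ∣ ∏ i, X (Sum.inl i) ^ r i :=
    (dvd_pow_self _ (hr j)).trans (Finset.dvd_prod_of_mem _ (Finset.mem_univ j))
  have h2 : (X (Sum.inl j) : BigP k m) ∣ incl k m (∏ i, X (Sum.inl i)) := by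
    rw [map_prod]
    simpa [incl] using
      Finset.dvd_prod_of_mem (fun i => (X (Sum.inl i) : BigP k m)) (Finset.mem_univ j)
  obtain ⟨a, ha⟩ := h1
  obtain ⟨b, hb⟩ := h2
  have h3 : incl k m (rename Sum.inr f) = rename (Sum.inr ∘ Fin.succ) f := by
    rw [incl, rename_rename]
    rfl
  refine ⟨a * X (Sum.inr 0) - b * incl k m g, ?_⟩
  rw [relG, ha, hF, map_add, map_mul, hb, h3]
  ring

section

variable {k m r F} {f : MvPolynomial (Fin 2) k}

theorem xA_dvd_mk_rename {j : Fin m} {h : BigP k m}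
    (hj : relG k m r F = X (Sum.inl j) * h - rename (Sum.inr ∘ Fin.succ) f) :
    xA k m r F j ∣ Ideal.Quotient.mk _ (rename (Sum.inr ∘ Fin.succ) f) := by
  refine ⟨Ideal.Quotient.mk _ h, ?_⟩
  have := (congrArg (Ideal.Quotient.mk (Ideal.span {relG k m r F})) hj).symm.trans (mk_relG k m r F)
  rw [map_sub, map_mul, sub_eq_zero] at this
  exact this.symm

theorem aeval_cons_rename (v : Fin m → k) (p : MvPolynomial (Fin 2) k) :
    aeval (Sum.elim (fun i => C (v i)) (Fin.cons 0 X) : _ → MvPolynomial (Fin 2) k)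
      (rename (Sum.inr ∘ Fin.succ) p) = p := by
  rw [aeval_rename, Function.comp_def]
  simp

/-- If `x_j` divides in `A` the image of `p`, then `f` divides every value of `p` at a point of
`k[Z,T]` with vanishing `j`-th coordinate. -/
theorem dvd_aeval_of_xA_dvd {j : Fin m} {h : BigP k m}
    (hj : relG k m r F = X (Sum.inl j) * h - rename (Sum.inr ∘ Fin.succ) f) (v : Fin m → k)
    (hv : v j = 0) {p : BigP k m} (hp : xA k m r F j ∣ Ideal.Quotient.mk _ p) :
    f ∣ aeval (Sum.elim (fun i => C (v i)) (Fin.cons 0 X) : _ → MvPolynomial (Fin 2) k) p := by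
  obtain ⟨c, hc⟩ := hp
  obtain ⟨c, rfl⟩ := Ideal.Quotient.mk_surjective c
  rw [xA, ← map_mul, Ideal.Quotient.eq, Ideal.mem_span_singleton] at hc
  obtain ⟨w, hw⟩ := hc
  rw [sub_eq_iff_eq_add] at hw
  rw [hw, hj, map_add, map_mul, map_sub, aeval_cons_rename, map_mul,
    map_mul, aeval_X, Sum.elim_inl, hv, map_zero]
  exact ⟨-aeval (Sum.elim (fun i => C (v i)) (Fin.cons 0 X) : _ → MvPolynomial (Fin 2) k) w, by ring⟩

theorem isUnit_of_isUnit_xA {j : Fin m} {h : BigP k m}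
    (hj : relG k m r F = X (Sum.inl j) * h - rename (Sum.inr ∘ Fin.succ) f)
    (hu : IsUnit (xA k m r F j)) : IsUnit f := by
  have := dvd_aeval_of_xA_dvd hj 0 rfl (p := 1) hu.dvd
  rw [map_one] at this
  exact isUnit_of_dvd_one this

theorem isUnit_xA {j : Fin m} {h : BigP k m}
    (hj : relG k m r F = X (Sum.inl j) * h - rename (Sum.inr ∘ Fin.succ) f)
    (hu : IsUnit f) : IsUnit (xA k m r F j) :=
  isUnit_of_dvd_unit (xA_dvd_mk_rename hj)
    ((hu.map (rename (Sum.inr ∘ Fin.succ))).map (Ideal.Quotient.mk _))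

theorem prime_of_prime_xA {j : Fin m} {h : BigP k m}
    (hj : relG k m r F = X (Sum.inl j) * h - rename (Sum.inr ∘ Fin.succ) f) (hf : f ≠ 0)
    (hp : Prime (xA k m r F j)) : Prime f := by
  refine ⟨hf, fun hu => hp.not_isUnit (isUnit_xA hj hu), fun a b hab => ?_⟩
  have h1 := (xA_dvd_mk_rename hj).trans
    (map_dvd (Ideal.Quotient.mk (Ideal.span {relG k m r F}))
      (map_dvd (rename (Sum.inr ∘ Fin.succ)) hab))
  rw [map_mul, map_mul] at h1
  refine (hp.dvd_or_dvd h1).imp (fun h2 => ?_) fun h2 => ?_ <;>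
  · have := dvd_aeval_of_xA_dvd hj 0 rfl h2
    rwa [aeval_cons_rename] at this

end

theorem prime_xA {k : Type} [Field k] {m : ℕ} {r : Fin m → ℕ} {F : MvPolynomial (Fin m ⊕ Fin 2) k}
    {f : MvPolynomial (Fin 2) k} {j : Fin m} {h : BigP k m}
    (hj : relG k m r F = X (Sum.inl j) * h - rename (Sum.inr ∘ Fin.succ) f) (hf : Prime f) :
    Prime (xA k m r F j) := by
  have hfp : Prime (rename (Sum.inr ∘ Fin.succ) f : BigP k m) :=
    prime_rename_of_injective (Sum.inr_injective.comp (Fin.succ_injective _)) hf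
  let ρ : BigP k m →ₐ[k] BigP k m := aeval fun i => if i = Sum.inl j then 0 else X i
  have hρj : ρ (X (Sum.inl j)) = 0 := by simp [ρ]
  have hρf : ρ (rename (Sum.inr ∘ Fin.succ) f) = rename (Sum.inr ∘ Fin.succ) f := by
    have h : ρ.comp (rename (Sum.inr ∘ Fin.succ)) = rename (Sum.inr ∘ Fin.succ) := by
      ext i
      simp [ρ]
    exact DFunLike.congr_fun h f
  have hρ : ∀ p, X (Sum.inl j) ∣ p - ρ p := fun p => by
    induction p using MvPolynomial.induction_on with
    | C c => simp [ρ]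
    | add p q hp hq =>
      rw [map_add, add_sub_add_comm]
      exact dvd_add hp hq
    | mul_X p i hp =>
      by_cases hi : i = Sum.inl j
      · subst hi
        rw [map_mul, hρj, mul_zero, sub_zero]
        exact dvd_mul_left _ _
      · have : ρ (X i) = X i := by simp [ρ, hi]
        rw [map_mul, this, ← sub_mul]
        exact hp.mul_right _
  have hdvd : ∀ p, rename (Sum.inr ∘ Fin.succ) f ∣ ρ p →
      xA k m r F j ∣ Ideal.Quotient.mk _ p := fun p hp => by
    rw [← sub_add_cancel p (ρ p), map_add]
    exact dvd_add (map_dvd _ (hρ p)) ((xA_dvd_mk_rename hj).trans (map_dvd _ hp))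
  refine ⟨?_, fun hu => hf.not_isUnit (isUnit_of_isUnit_xA hj hu), fun a b hab => ?_⟩
  · rw [← toA_X_inl, Ne, map_eq_zero_iff _ (toA_injective k m r F)]
    exact X_ne_zero _
  · obtain ⟨u, rfl⟩ := Ideal.Quotient.mk_surjective a
    obtain ⟨v, rfl⟩ := Ideal.Quotient.mk_surjective b
    obtain ⟨c, hc⟩ := hab
    obtain ⟨c, rfl⟩ := Ideal.Quotient.mk_surjective c
    rw [xA, ← map_mul, ← map_mul, Ideal.Quotient.eq, Ideal.mem_span_singleton] at hc
    obtain ⟨w, hw⟩ := hc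
    have h1 : ρ u * ρ v = rename (Sum.inr ∘ Fin.succ) f * (-ρ w) := by
      have := congrArg ρ hw
      rw [hj, map_sub, map_mul, map_mul, map_mul, map_sub, map_mul, hρj, hρf] at this
      linear_combination this
    exact (hfp.dvd_or_dvd ⟨_, h1⟩).imp (hdvd u) (hdvd v)

/-- If `f` is not a unit and `A` is factorial, then some `x_j` is prime. -/
theorem exists_prime_xA {k : Type} [Field k] {m : ℕ} (hm : 1 ≤ m) {r : Fin m → ℕ}
    {F : MvPolynomial (Fin m ⊕ Fin 2) k} {f : MvPolynomial (Fin 2) k} [IsDomain (RingA k m r F)]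
    [UniqueFactorizationMonoid (RingA k m r F)]
    (hj : ∀ j, ∃ h, relG k m r F = X (Sum.inl j) * h - rename (Sum.inr ∘ Fin.succ) f)
    (hf : ¬ IsUnit f) : ∃ j, Prime (xA k m r F j) := by
  have hx0 : ∀ j, xA k m r F j ≠ 0 := fun j => by
    rw [← toA_X_inl, Ne, map_eq_zero_iff _ (toA_injective k m r F)]
    exact X_ne_zero _
  have hxu : ∀ j, ¬ IsUnit (xA k m r F j) := fun j hu =>
    let ⟨_, h⟩ := hj j
    hf (isUnit_of_isUnit_xA h hu)
  have hndvd : ∀ j (e : Fin m → ℕ), e j = 0 → ¬ xA k m r F j ∣ ∏ i, xA k m r F i ^ e i := by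
    intro j e he hd
    obtain ⟨h, hh⟩ := hj j
    have h1 : ∏ i, xA k m r F i ^ e i =
        Ideal.Quotient.mk _ (∏ i, X (Sum.inl i) ^ e i) := by simp [xA, map_prod]
    rw [h1] at hd
    have := dvd_aeval_of_xA_dvd hh (fun i => if i = j then 0 else 1) (by simp) hd
    refine hf (isUnit_of_dvd_one (this.trans (dvd_of_eq ?_)))
    rw [map_prod]
    refine Finset.prod_eq_one fun i _ => ?_
    by_cases hi : i = j
    · subst hi; simp [he]
    · simp [hi]
  let j₀ : Fin m := ⟨0, hm⟩
  obtain ⟨π, hπ, b, hb⟩ := WfDvdMonoid.exists_irreducible_factor (hxu j₀) (hx0 j₀)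
  have hcl : ∀ d ∈ Submonoid.closure
      (Set.range fun i : Fin m => (X (Sum.inl i) : MvPolynomial (Fin m ⊕ Fin 2) k)),
      ∃ e : Fin m → ℕ, d = ∏ i, X (Sum.inl i) ^ e i := fun d hd => by
    obtain ⟨e, he⟩ := (Submonoid.mem_closure_range_iff_of_fintype).1 hd
    exact ⟨e, he⟩
  have hmap : ∀ e : Fin m → ℕ, toA k m r F (∏ i, X (Sum.inl i) ^ e i) =
      ∏ i, xA k m r F i ^ e i := fun e => by
    simp [map_prod, toA_X_inl]
  have hmon : ∃ e e' : Fin m → ℕ, Associated ((∏ i, xA k m r F i ^ e i) * π)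
      (∏ i, xA k m r F i ^ e' i) := by
    obtain ⟨d, hd, p, hp⟩ := exists_toA_mul_eq_toA k m r F π
    obtain ⟨d', hd', p', hp'⟩ := exists_toA_mul_eq_toA k m r F b
    have h1 : p * p' = d * d' * X (Sum.inl j₀) := toA_injective k m r F (by
      rw [map_mul, map_mul, map_mul, toA_X_inl, hb, ← hp, ← hp']
      ring)
    obtain ⟨e₁, he₁⟩ := hcl _ (mul_mem (mul_mem hd hd') (Submonoid.subset_closure ⟨j₀, rfl⟩))
    obtain ⟨e, he⟩ := hcl d hd
    obtain ⟨e', he'⟩ := exists_associated_prod_pow_of_dvd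
      (fun i => (MvPolynomial.X_prime : Prime (X (Sum.inl i) : MvPolynomial (Fin m ⊕ Fin 2) k)))
      Finset.univ e₁ (d := p) ⟨p', (h1.trans he₁).symm⟩
    refine ⟨e, e', ?_⟩
    have := he'.map (toA k m r F)
    rwa [← hp, he, hmap, hmap] at this
  obtain ⟨e, e', h, hee⟩ : ∃ e e' : Fin m → ℕ, Associated ((∏ i, xA k m r F i ^ e i) * π)
      (∏ i, xA k m r F i ^ e' i) ∧ ∀ i, e i = 0 ∨ e' i = 0 := by
    obtain ⟨e, e', h⟩ := hmon
    have hsplit : ∀ e e' : Fin m → ℕ, ∏ i, xA k m r F i ^ e i =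
        (∏ i, xA k m r F i ^ min (e i) (e' i)) * ∏ i, xA k m r F i ^ (e i - e' i) := fun e e' => by
      rw [← Finset.prod_mul_distrib]
      exact Finset.prod_congr rfl fun i _ => by rw [← pow_add]; congr 1; omega
    refine ⟨fun i => e i - e' i, fun i => e' i - e i, ?_, fun i => by dsimp only; omega⟩
    rw [hsplit e e', hsplit e' e, mul_assoc] at h
    simp only [min_comm (e' _)] at h
    exact Associated.of_mul_left h (Associated.refl _)
      (Finset.prod_ne_zero_iff.2 fun i _ => pow_ne_zero _ (hx0 i))
  have he0 : ∀ i, e i = 0 := fun i => by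
    by_contra hi
    refine hndvd i e' ((hee i).resolve_left hi) (dvd_trans ?_ h.dvd)
    exact ((dvd_pow_self _ hi).trans (Finset.dvd_prod_of_mem (fun i => xA k m r F i ^ e i)
      (Finset.mem_univ i))).mul_right _
  simp only [he0, pow_zero, Finset.prod_const_one, one_mul] at h
  obtain ⟨i, hi⟩ : ∃ i, e' i ≠ 0 := by
    by_contra! h0
    simp only [h0, pow_zero, Finset.prod_const_one] at h
    exact hπ.not_isUnit (associated_one_iff_isUnit.1 h)
  have hd : xA k m r F i ∣ π :=
    ((dvd_pow_self _ hi).trans (Finset.dvd_prod_of_mem (fun i => xA k m r F i ^ e' i)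
      (Finset.mem_univ i))).trans h.symm.dvd
  exact ⟨i, (((hπ.dvd_iff.1 hd).resolve_left (hxu i)).prime_iff).1 hπ.prime⟩

/-!
STATEMENT 4.  Suppose `F = f(Z,T) + X_1⋯X_m·g(X_1,…,X_m,Z,T)`.  Then the following are
equivalent: (i) `A` is a UFD; (ii) for each `j`, `x_j` is a prime element of `A` or a
unit of `A`; (iii) `f(Z,T)` is an irreducible element of `k[Z,T]` or a nonzero element
of `k`.
-/

theorem statement4 (k : Type) [Field k] (m : ℕ) (hm : 1 ≤ m)
    (r : Fin m → ℕ) (hr : ∀ i, 1 < r i)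
    (F : MvPolynomial (Fin m ⊕ Fin 2) k) (hf : fOf k m F ≠ 0)
    [IsDomain (RingA k m r F)]
    (g : MvPolynomial (Fin m ⊕ Fin 2) k)
    (hFg : F = rename Sum.inr (fOf k m F) + (∏ i, X (Sum.inl i)) * g) :
    List.TFAE
      [ UniqueFactorizationMonoid (RingA k m r F),
        ∀ j : Fin m, Prime (xA k m r F j) ∨ IsUnit (xA k m r F j),
        Irreducible (fOf k m F) ∨ ∃ c : k, c ≠ 0 ∧ fOf k m F = C c ] := by
  have hrel := exists_relG_eq k m r F (fun i => (zero_lt_one.trans (hr i)).ne') hFg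
  have hunit : IsUnit (fOf k m F) ↔ ∃ c : k, c ≠ 0 ∧ fOf k m F = C c := by
    simp [isUnit_iff_eq_C_of_isReduced]
  rw [← hunit]
  tfae_have 1 → 3 := fun _ => by
    by_cases hu : IsUnit (fOf k m F)
    · exact Or.inr hu
    · obtain ⟨j, hp⟩ := exists_prime_xA hm hrel hu
      obtain ⟨h, hj⟩ := hrel j
      exact Or.inl (prime_of_prime_xA hj hf hp).irreducible
  tfae_have 3 → 2 := fun h3 j => by
    obtain ⟨h, hj⟩ := hrel j
    exact h3.imp (fun hi => prime_xA hj hi.prime) fun hu => isUnit_xA hj hu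
  tfae_have 2 → 1 := fun h2 =>
    UniqueFactorizationMonoid.of_prime_or_isUnit_of_injective (toA k m r F).toRingHom
      (toA_injective k m r F) _ (by rintro _ ⟨j, rfl⟩; simpa [toA_X_inl] using h2 j)
      (exists_toA_mul_eq_toA k m r F)
  tfae_finish
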